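/- arXiv:2305.00458 — 6 statements merged into one kernel-verified Lean document; each statement's English description precedes it below -/
import Mathlib

section
/- Let α > 0 with α ∉ ℤ, m = ⌈α⌉, L > 0, and let f : ℝ → ℝ be m times continuously differentiable. Then for every t ∈ ℝ, (1/Γ(m−α)) ∫_{t−L}^{t} (t−τ)^{m−α−1} f⁽ᵐ⁾(τ) dτ = (L^{m−α}/Γ(m−α+1)) ∫_0^1 f⁽ᵐ⁾(t − L·y^{1/(m−α)}) dy; that is, the change of variables τ = t − L·y^{1/(m−α)} transforms the Caputo fractional derivative with sliding memory length L into its reduced form with constant integration limits. -/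
open MeasureTheory intervalIntegral

/-- The substitution `τ = t - L * y ^ (1 / β)` turns an integral against the weakly singular
kernel `(t - τ) ^ (β - 1)` over `[t - L, t]` into an unweighted integral over `[0, 1]`. -/
theorem integral_sub_rpow_mul_eq_integral_comp_rpow {β L : ℝ} (hβ : 0 < β) (hL : 0 < L)
    (g : ℝ → ℝ) (t : ℝ) :
    ∫ τ in (t - L)..t, (t - τ) ^ (β - 1) * g τ
      = L ^ β / β * ∫ y in (0 : ℝ)..1, g (t - L * y ^ (1 / β)) := by
  have hlt : t - L < t := by linarith
  have key := integral_comp_mul_deriv_of_deriv_nonpos (a := t - L) (b := t)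
    (f := fun τ => ((t - τ) / L) ^ β)
    (f' := fun τ => -1 / L * β * ((t - τ) / L) ^ (β - 1))
    (g := fun y => g (t - L * y ^ (1 / β))) ?_ ?_ ?_
  · rw [sub_sub_cancel, div_self hL.ne', Real.one_rpow, sub_self, zero_div,
      Real.zero_rpow hβ.ne', integral_symm 0 1] at key
    rw [← neg_eq_iff_eq_neg.mpr key, ← intervalIntegral.integral_neg,
      ← intervalIntegral.integral_const_mul]
    refine integral_congr fun τ hτ => ?_
    rw [Set.uIcc_of_le hlt.le] at hτ
    have h0 : 0 ≤ t - τ := by linarith [hτ.2]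
    have h1 : 0 ≤ (t - τ) / L := by positivity
    have h2 : t - L * ((t - τ) / L) = τ := by field_simp; ring
    simp only [Function.comp_apply]
    rw [← Real.rpow_mul h1, mul_one_div_cancel hβ.ne', Real.rpow_one, h2,
      Real.div_rpow h0 hL.le, Real.rpow_sub_one hL.ne' β]
    have h3 : L ^ β ≠ 0 := (Real.rpow_pos_of_pos hL β).ne'
    field_simp
  · exact (Continuous.rpow_const (by fun_prop) fun _ => Or.inr hβ.le).continuousOn
  · intro τ hτ
    rw [max_eq_right hlt.le] at hτ
    have h : 0 < (t - τ) / L := div_pos (by linarith [hτ.2]) hL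
    exact (((hasDerivAt_id τ).const_sub t).div_const L).rpow_const (Or.inl h.ne')
  · intro τ hτ
    rw [max_eq_right hlt.le] at hτ
    have h : 0 < (t - τ) / L := div_pos (by linarith [hτ.2]) hL
    have h4 : -1 / L ≤ 0 := div_nonpos_of_nonpos_of_nonneg (by norm_num) hL.le
    exact mul_nonpos_of_nonpos_of_nonneg (mul_nonpos_of_nonpos_of_nonneg h4 hβ.le)
      (Real.rpow_nonneg h.le _)

/-- The change of variables τ = t − L·y^{1/(m−α)} transforms the Caputo fractional
derivative with sliding memory length `L` into its reduced form with constant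
integration limits. -/
theorem caputo_sliding_eq_reduced
    (α : ℝ) (hα : 0 < α) (hαz : ∀ n : ℤ, α ≠ n) (m : ℕ) (hm : m = ⌈α⌉₊)
    (L : ℝ) (hL : 0 < L) (f : ℝ → ℝ) (hf : ContDiff ℝ m f) (t : ℝ) :
    (1 / Real.Gamma ((m : ℝ) - α)) *
        ∫ τ in (t - L)..t, (t - τ) ^ ((m : ℝ) - α - 1) * iteratedDeriv m f τ
      = (L ^ ((m : ℝ) - α) / Real.Gamma ((m : ℝ) - α + 1)) *
        ∫ y in (0 : ℝ)..1, iteratedDeriv m f (t - L * y ^ (1 / ((m : ℝ) - α))) := by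
  have hβ : 0 < (m : ℝ) - α := by
    have hle : α ≤ m := hm ▸ Nat.le_ceil α
    have hne : α ≠ m := mod_cast hαz m
    exact sub_pos.mpr (lt_of_le_of_ne hle hne)
  have hΓ := (Real.Gamma_pos_of_pos hβ).ne'
  rw [integral_sub_rpow_mul_eq_integral_comp_rpow hβ hL, Real.Gamma_add_one hβ.ne']
  field_simp
end

section
/- Let α ∈ (0,1), L > 0, and let f : ℝ → ℝ be continuously differentiable. Then for every t ∈ ℝ, (1/Γ(1−α)) ∫_{t−L}^{t} (t−τ)^{−α} f′(τ) dτ = (L^{1−α}/Γ(2−α)) ∫_0^1 f′(t − L·y^{1/(1−α)}) dy. -/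
open MeasureTheory intervalIntegral

/-- The change of variables `y = x ^ p` on the unit interval. -/
lemma integral_rpow_sub_one_mul_eq_integral_comp_rpow_inv {p : ℝ} (hp : 0 < p) (g : ℝ → ℝ) :
    ∫ x in (0 : ℝ)..1, p * x ^ (p - 1) * g x = ∫ y in (0 : ℝ)..1, g (y ^ (1 / p)) := by
  have himage : (fun x : ℝ => x ^ p) '' Set.Ioc 0 1 = Set.Ioc 0 1 := by
    ext y
    constructor
    · rintro ⟨x, hx, rfl⟩
      exact ⟨Real.rpow_pos_of_pos hx.1 p, Real.rpow_le_one hx.1.le hx.2 hp.le⟩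
    · intro hy
      refine ⟨y ^ (1 / p), ⟨Real.rpow_pos_of_pos hy.1 _,
        Real.rpow_le_one hy.1.le hy.2 (by positivity)⟩, ?_⟩
      simp [← Real.rpow_mul hy.1.le, hp.ne']
  have key := integral_image_eq_integral_abs_deriv_smul (s := Set.Ioc (0 : ℝ) 1)
    (f := fun x : ℝ => x ^ p) (f' := fun x => p * x ^ (p - 1)) measurableSet_Ioc
    (fun x hx => (Real.hasDerivAt_rpow_const (Or.inl hx.1.ne')).hasDerivWithinAt)
    ((Real.rpow_left_injOn hp.ne').mono fun x hx => hx.1.le) (fun y => g (y ^ (1 / p)))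
  rw [himage] at key
  rw [integral_of_le zero_le_one, integral_of_le zero_le_one, key]
  refine setIntegral_congr_fun measurableSet_Ioc fun x hx => ?_
  have hpos : 0 ≤ p * x ^ (p - 1) := mul_nonneg hp.le (Real.rpow_nonneg hx.1.le _)
  simp [abs_of_nonneg hpos, ← Real.rpow_mul hx.1.le, hp.ne']

/-- Rescaling a weakly singular integral over a window of length `L` to the unit interval. -/
lemma integral_sub_rpow_mul_eq_rescaled {L : ℝ} (hL : 0 < L) (r t : ℝ) (g : ℝ → ℝ) :
    ∫ τ in (t - L)..t, (t - τ) ^ r * g τ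
      = L ^ (r + 1) * ∫ x in (0 : ℝ)..1, x ^ r * g (t - L * x) := by
  have h := intervalIntegral.mul_integral_comp_sub_mul (a := 0) (b := 1)
    (f := fun τ => (t - τ) ^ r * g τ) (c := L) (d := t)
  simp only [mul_one, mul_zero, sub_zero, sub_sub_cancel] at h
  rw [← h, Real.rpow_add_one hL.ne', mul_comm (L ^ r), mul_assoc,
    ← intervalIntegral.integral_const_mul (L ^ r)]
  congr 1
  refine integral_congr fun x hx => ?_
  rw [Set.uIcc_of_le zero_le_one] at hx
  simp only [Real.mul_rpow hL.le hx.1, mul_assoc]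

/-- For 0 < α < 1, the Caputo fractional derivative with sliding memory length `L`
equals its reduced form with constant integration limits. -/
theorem caputo_sliding_eq_reduced_of_lt_one
    (α : ℝ) (hα : α ∈ Set.Ioo (0 : ℝ) 1) (L : ℝ) (hL : 0 < L)
    (f : ℝ → ℝ) (hf : ContDiff ℝ 1 f) (t : ℝ) :
    (1 / Real.Gamma (1 - α)) * ∫ τ in (t - L)..t, (t - τ) ^ (-α) * deriv f τ
      = (L ^ (1 - α) / Real.Gamma (2 - α)) *
        ∫ y in (0 : ℝ)..1, deriv f (t - L * y ^ (1 / (1 - α))) := by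
  have hp : 0 < 1 - α := sub_pos.mpr hα.2
  have hΓ : Real.Gamma (2 - α) = (1 - α) * Real.Gamma (1 - α) := by
    rw [← Real.Gamma_add_one hp.ne']
    ring_nf
  have hΓpos := Real.Gamma_pos_of_pos hp
  rw [integral_sub_rpow_mul_eq_rescaled hL,
    ← integral_rpow_sub_one_mul_eq_integral_comp_rpow_inv hp (fun x => deriv f (t - L * x)), hΓ]
  simp only [mul_assoc, intervalIntegral.integral_const_mul]
  rw [show 1 - α - 1 = -α by ring, show -α + 1 = 1 - α by ring]
  field_simp
end

section
/- Let α > 0 with α ∉ ℤ, m = ⌈α⌉, L > 0, and let f : ℝ → ℝ be m times continuously differentiable. Then the function t ↦ ∫_{t−L}^{t} (t−τ)^{m−α−1} f(τ) dτ is m times differentiable on ℝ and its m-th derivative equals ∫_{t−L}^{t} (t−τ)^{m−α−1} f⁽ᵐ⁾(τ) dτ for every t ∈ ℝ. Consequently, the Riemann–Liouville fractional derivative with sliding memory length L coincides with the Caputo fractional derivative with sliding memory length L for m times continuously differentiable functions. -/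
open MeasureTheory intervalIntegral

theorem ContDiff.iteratedDeriv_one {f : ℝ → ℝ} {m n : ℕ} (hf : ContDiff ℝ m f) (hn : n < m) :
    ContDiff ℝ 1 (iteratedDeriv n f) := by
  rw [iteratedDeriv_eq_iterate]
  exact ContDiff.iterate_deriv' 1 n (hf.of_le (by exact_mod_cast (by lia : 1 + n ≤ m)))

theorem integral_sliding_eq (k g : ℝ → ℝ) (L t : ℝ) :
    ∫ τ in (t - L)..t, k (t - τ) * g τ = ∫ x in (0 : ℝ)..L, k x * g (t - x) := by
  have h := integral_comp_sub_left (a := t - L) (b := t) (fun x => k x * g (t - x)) t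
  simpa using h

theorem hasDerivAt_integral_mul_comp_sub {k g : ℝ → ℝ} {a b : ℝ}
    (hk : IntervalIntegrable k volume a b) (hg : ContDiff ℝ 1 g) (t : ℝ) :
    HasDerivAt (fun t => ∫ x in a..b, k x * g (t - x))
      (∫ x in a..b, k x * deriv g (t - x)) t := by
  have hg' : Continuous (deriv g) := hg.continuous_deriv le_rfl
  have hint (h : ℝ → ℝ) (hh : Continuous h) (s : ℝ) :
      IntervalIntegrable (fun x => k x * h (s - x)) volume a b :=
    hk.mul_continuousOn (hh.comp (continuous_const.sub continuous_id)).continuousOn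
  obtain ⟨C, hC⟩ := ((isCompact_closedBall t 1).prod (isCompact_uIcc (a := a) (b := b)))
    |>.exists_bound_of_continuousOn
      (f := fun p : ℝ × ℝ => deriv g (p.1 - p.2)) (by fun_prop)
  refine (hasDerivAt_integral_of_dominated_loc_of_deriv_le
    (F := fun s x => k x * g (s - x)) (F' := fun s x => k x * deriv g (s - x))
    (bound := fun x => ‖k x‖ * C) (Metric.closedBall_mem_nhds t one_pos)
    (.of_forall fun s => (hint g hg.continuous s).aestronglyMeasurable_restrict_uIoc)
    (hint g hg.continuous t) (hint _ hg' t).aestronglyMeasurable_restrict_uIoc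
    (.of_forall fun x hx s hs => ?_) (hk.norm.mul_const C)
    (.of_forall fun x _ s _ => ?_)).2
  · rw [norm_mul]
    exact mul_le_mul_of_nonneg_left (hC (s, x) ⟨hs, Set.uIoc_subset_uIcc hx⟩) (norm_nonneg _)
  · have hd := (hg.differentiable one_ne_zero (s - x)).hasDerivAt
    exact (hd.comp_sub_const s x).const_mul (k x)

theorem iteratedDeriv_integral_mul_comp_sub {k : ℝ → ℝ} {a b : ℝ}
    (hk : IntervalIntegrable k volume a b) {f : ℝ → ℝ} {m n : ℕ} (hf : ContDiff ℝ m f)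
    (hn : n ≤ m) :
    iteratedDeriv n (fun t => ∫ x in a..b, k x * f (t - x)) =
      fun t => ∫ x in a..b, k x * iteratedDeriv n f (t - x) := by
  induction n with
  | zero => simp
  | succ n ih =>
    rw [iteratedDeriv_succ, ih (by lia)]
    funext t
    rw [iteratedDeriv_succ]
    exact (hasDerivAt_integral_mul_comp_sub hk (hf.iteratedDeriv_one hn) t).deriv

/-- The map t ↦ ∫_{t−L}^{t} (t−τ)^{m−α−1} f(τ) dτ is m times differentiable and its
m-th derivative equals ∫_{t−L}^{t} (t−τ)^{m−α−1} f⁽ᵐ⁾(τ) dτ; consequently the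
Riemann–Liouville and Caputo fractional derivatives with sliding memory length `L`
coincide for m times continuously differentiable functions. -/
theorem riemannLiouville_sliding_eq_caputo_sliding
    (α : ℝ) (hα : 0 < α) (hαz : ∀ n : ℤ, α ≠ n) (m : ℕ) (hm : m = ⌈α⌉₊)
    (L : ℝ) (hL : 0 < L) (f : ℝ → ℝ) (hf : ContDiff ℝ m f) :
    (∀ n < m, Differentiable ℝ (iteratedDeriv n
        (fun t : ℝ => ∫ τ in (t - L)..t, (t - τ) ^ ((m : ℝ) - α - 1) * f τ))) ∧
    (∀ t : ℝ, iteratedDeriv m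
        (fun t : ℝ => ∫ τ in (t - L)..t, (t - τ) ^ ((m : ℝ) - α - 1) * f τ) t
      = ∫ τ in (t - L)..t, (t - τ) ^ ((m : ℝ) - α - 1) * iteratedDeriv m f τ) ∧
    (∀ t : ℝ, (1 / Real.Gamma ((m : ℝ) - α)) * iteratedDeriv m
        (fun t : ℝ => ∫ τ in (t - L)..t, (t - τ) ^ ((m : ℝ) - α - 1) * f τ) t
      = (1 / Real.Gamma ((m : ℝ) - α)) *
        ∫ τ in (t - L)..t, (t - τ) ^ ((m : ℝ) - α - 1) * iteratedDeriv m f τ) := by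
  have hr : -1 < (m : ℝ) - α - 1 := by
    have hle : α ≤ m := hm ▸ Nat.le_ceil α
    have hlt : α < m := lt_of_le_of_ne hle (by exact_mod_cast hαz m)
    linarith
  have hk : IntervalIntegrable (fun x : ℝ => x ^ ((m : ℝ) - α - 1)) volume 0 L :=
    intervalIntegrable_rpow' hr
  have hslide (g : ℝ → ℝ) (t : ℝ) :=
    integral_sliding_eq (fun x => x ^ ((m : ℝ) - α - 1)) g L t
  simp only [hslide]
  have hderiv := iteratedDeriv_integral_mul_comp_sub hk hf le_rfl
  refine ⟨fun n hn t => ?_, fun t => congrFun hderiv t, fun t => by rw [hderiv]⟩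
  rw [iteratedDeriv_integral_mul_comp_sub hk hf hn.le]
  exact (hasDerivAt_integral_mul_comp_sub hk
    (hf.iteratedDeriv_one hn) t).differentiableAt
end

section
/- Let α > 0 with α ∉ ℤ, m = ⌈α⌉, L > 0, T > 0, and let f : ℝ → ℝ be m times continuously differentiable and T-periodic, i.e., f(t+T) = f(t) for all t ∈ ℝ. Then the Caputo fractional derivative with sliding memory length L of f is T-periodic: ᴹD^α_L f(t+T) = ᴹD^α_L f(t) for all t ∈ ℝ. -/
open MeasureTheory intervalIntegral

/-- The Caputo fractional derivative with sliding memory length `L` of a T-periodic,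
m times continuously differentiable function is T-periodic. -/
theorem caputo_sliding_periodic
    (α : ℝ) (hα : 0 < α) (hαz : ∀ n : ℤ, α ≠ n) (m : ℕ) (hm : m = ⌈α⌉₊)
    (L T : ℝ) (hL : 0 < L) (hT : 0 < T) (f : ℝ → ℝ) (hf : ContDiff ℝ m f)
    (hper : ∀ t : ℝ, f (t + T) = f t) (t : ℝ) :
    (1 / Real.Gamma ((m : ℝ) - α)) *
        ∫ τ in (t + T - L)..(t + T), (t + T - τ) ^ ((m : ℝ) - α - 1) * iteratedDeriv m f τ
      = (1 / Real.Gamma ((m : ℝ) - α)) *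
        ∫ τ in (t - L)..t, (t - τ) ^ ((m : ℝ) - α - 1) * iteratedDeriv m f τ := by
  have hderiv (τ : ℝ) : iteratedDeriv m f (τ + T) = iteratedDeriv m f τ := by
    rw [← congrFun (iteratedDeriv_comp_add_const m f T) τ, funext hper]
  rw [show t + T - L = t - L + T by ring,
    ← integral_comp_add_right
      (fun τ => (t + T - τ) ^ ((m : ℝ) - α - 1) * iteratedDeriv m f τ) T]
  simp only [hderiv, add_sub_add_right_eq_sub]
end

section
/- Let m be a positive integer, L > 0, t ∈ ℝ, and let f : ℝ → ℝ be m times continuously differentiable with f⁽ᵐ⁾ bounded on ℝ. Then the reduced fractional derivative with sliding memory length L converges to the ordinary m-th derivative as the fractional order tends to m from below: lim_{α→m⁻} (L^{m−α}/Γ(m−α+1)) ∫_0^1 f⁽ᵐ⁾(t − L·y^{1/(m−α)}) dy = f⁽ᵐ⁾(t), where the limit is taken over α ∈ (m−1, m). -/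
open MeasureTheory intervalIntegral Filter

/-- The reduced fractional derivative with sliding memory length `L` converges to the
ordinary m-th derivative as the fractional order α tends to m from below (over
α ∈ (m−1, m)), provided f is m times continuously differentiable with bounded m-th
derivative. -/
theorem reduced_sliding_tendsto_iteratedDeriv
    (m : ℕ) (hm : 0 < m) (L : ℝ) (hL : 0 < L) (t : ℝ) (f : ℝ → ℝ)
    (hf : ContDiff ℝ m f) (hbdd : ∃ C : ℝ, ∀ x : ℝ, |iteratedDeriv m f x| ≤ C) :
    Tendsto (fun α : ℝ =>
        (L ^ ((m : ℝ) - α) / Real.Gamma ((m : ℝ) - α + 1)) *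
          ∫ y in (0 : ℝ)..1, iteratedDeriv m f (t - L * y ^ (1 / ((m : ℝ) - α))))
      (nhdsWithin (m : ℝ) (Set.Ioo ((m : ℝ) - 1) (m : ℝ)))
      (nhds (iteratedDeriv m f t)) := by
  obtain ⟨C, hC⟩ := hbdd
  have hcont : Continuous (iteratedDeriv m f) := hf.continuous_iteratedDeriv m le_rfl
  have hsub : Tendsto (fun α : ℝ => (m : ℝ) - α)
      (nhdsWithin (m : ℝ) (Set.Ioo ((m : ℝ) - 1) (m : ℝ))) (nhds 0) := by
    have h : Continuous fun α : ℝ => (m : ℝ) - α := by fun_prop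
    simpa using (h.tendsto (m : ℝ)).mono_left nhdsWithin_le_nhds
  have hexp : Tendsto (fun α : ℝ => 1 / ((m : ℝ) - α))
      (nhdsWithin (m : ℝ) (Set.Ioo ((m : ℝ) - 1) (m : ℝ))) atTop := by
    simp only [one_div]
    refine tendsto_inv_nhdsGT_zero.comp (tendsto_nhdsWithin_iff.2 ⟨hsub, ?_⟩)
    filter_upwards [self_mem_nhdsWithin] with α hα
    exact sub_pos.2 hα.2
  have hfactor : Tendsto (fun α : ℝ => L ^ ((m : ℝ) - α) / Real.Gamma ((m : ℝ) - α + 1))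
      (nhdsWithin (m : ℝ) (Set.Ioo ((m : ℝ) - 1) (m : ℝ))) (nhds 1) := by
    have hpow := (Real.continuousAt_const_rpow (b := 0) hL.ne').tendsto.comp hsub
    have hGamma : ContinuousAt Real.Gamma (0 + 1) :=
      (Real.differentiableOn_Gamma_Ioi.differentiableAt (Ioi_mem_nhds (by norm_num))).continuousAt
    have hquot := hpow.div (hGamma.tendsto.comp (hsub.add_const 1)) (by simp)
    simpa [Function.comp_def, Pi.div_def] using hquot
  have hintegral : Tendsto (fun α : ℝ =>
      ∫ y in (0 : ℝ)..1, iteratedDeriv m f (t - L * y ^ (1 / ((m : ℝ) - α))))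
      (nhdsWithin (m : ℝ) (Set.Ioo ((m : ℝ) - 1) (m : ℝ)))
      (nhds (∫ _ in (0 : ℝ)..1, iteratedDeriv m f t)) := by
    refine tendsto_integral_filter_of_dominated_convergence (fun _ => C) ?_ ?_
      intervalIntegrable_const ?_
    · refine Eventually.of_forall fun α => Measurable.aestronglyMeasurable ?_
      exact hcont.measurable.comp (by fun_prop)
    · exact Eventually.of_forall fun α => Eventually.of_forall fun y _ => hC _
    · filter_upwards [Measure.ae_ne volume (1 : ℝ)] with y hy1 hy
      rw [Set.uIoc_of_le zero_le_one] at hy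
      have hrpow := (tendsto_rpow_atTop_of_base_lt_one y (by linarith [hy.1])
        (lt_of_le_of_ne hy.2 hy1)).comp hexp
      have harg := (hrpow.const_mul L).const_sub t
      rw [mul_zero, sub_zero] at harg
      exact (hcont.tendsto t).comp harg
  simpa using hfactor.mul hintegral
end

section
/- Fix L > 0 and t ∈ ℝ. Then lim_{α→2⁻} (L^{2−α}/Γ(3−α)) ∫_0^1 (−sin(t − L·y^{1/(2−α)})) dy = −sin(t), where the limit is taken over α ∈ (1,2); that is, the reduced fractional derivative with sliding memory length L of the sine function converges pointwise to −sin as the fractional order α tends to 2 from below. -/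
open MeasureTheory intervalIntegral Filter

/-- As the exponent `p` tends to infinity, `y ^ p` concentrates at `0` on the unit interval. -/
theorem tendsto_integral_comp_rpow_atTop {g : ℝ → ℝ} (hg : Continuous g) :
    Tendsto (fun p : ℝ => ∫ y in (0 : ℝ)..1, g (y ^ p)) atTop (nhds (g 0)) := by
  obtain ⟨C, hC⟩ := isCompact_Icc.exists_bound_of_continuousOn
    (s := Set.Icc (0 : ℝ) 1) hg.continuousOn
  have key : Tendsto (fun p : ℝ => ∫ y in (0 : ℝ)..1, g (y ^ p)) atTop
      (nhds (∫ _ in (0 : ℝ)..1, g 0)) := by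
    refine intervalIntegral.tendsto_integral_filter_of_dominated_convergence (fun _ => C)
      ?_ ?_ intervalIntegrable_const ?_
    · exact Eventually.of_forall fun p =>
        (hg.measurable.comp (measurable_id.pow_const p)).aestronglyMeasurable
    · filter_upwards [eventually_ge_atTop (0 : ℝ)] with p hp
      refine Eventually.of_forall fun y hy => ?_
      rw [Set.uIoc_of_le zero_le_one] at hy
      exact hC _ ⟨Real.rpow_nonneg hy.1.le p, Real.rpow_le_one hy.1.le hy.2 hp⟩
    · filter_upwards [Measure.ae_ne volume (1 : ℝ)] with y hne hy
      rw [Set.uIoc_of_le zero_le_one] at hy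
      exact (hg.tendsto 0).comp (tendsto_rpow_atTop_of_base_lt_one y
        (by linarith [hy.1]) (lt_of_le_of_ne hy.2 hne))
  simpa using key

/-- The reduced fractional derivative with sliding memory length `L` of the sine
function converges pointwise to −sin as the fractional order α tends to 2 from below
(over α ∈ (1,2)). -/
theorem reduced_sliding_sin_tendsto_neg_sin
    (L : ℝ) (hL : 0 < L) (t : ℝ) :
    Tendsto (fun α : ℝ =>
        (L ^ ((2 : ℝ) - α) / Real.Gamma (3 - α)) *
          ∫ y in (0 : ℝ)..1, -Real.sin (t - L * y ^ (1 / (2 - α))))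
      (nhdsWithin (2 : ℝ) (Set.Ioo (1 : ℝ) 2))
      (nhds (-Real.sin t)) := by
  have hsub : Tendsto (fun α : ℝ => 2 - α) (nhdsWithin 2 (Set.Ioo 1 2))
      (nhdsWithin 0 (Set.Ioi 0)) := by
    refine tendsto_nhdsWithin_iff.2 ⟨?_, ?_⟩
    · have h : ContinuousAt (fun α : ℝ => 2 - α) 2 := by fun_prop
      simpa using h.tendsto.mono_left nhdsWithin_le_nhds
    · filter_upwards [self_mem_nhdsWithin] with α hα
      exact sub_pos.2 hα.2
  have hcoef : Tendsto (fun α : ℝ => L ^ (2 - α) / Real.Gamma (3 - α))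
      (nhdsWithin 2 (Set.Ioo 1 2)) (nhds 1) := by
    have hpow : ContinuousAt (fun α : ℝ => L ^ (2 - α)) 2 :=
      ContinuousAt.rpow continuousAt_const (by fun_prop) (Or.inl hL.ne')
    have hGamma : ContinuousAt (fun α : ℝ => Real.Gamma (3 - α)) 2 := by
      refine ContinuousAt.comp (g := Real.Gamma) ?_ (by fun_prop)
      exact (Real.differentiableAt_Gamma fun m h => by
        linarith [(Nat.cast_nonneg m : (0 : ℝ) ≤ m)]).continuousAt
    have h2 : (3 : ℝ) - 2 = 1 := by norm_num
    have h := (hpow.div hGamma (by simp [h2])).tendsto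
    simp only [Pi.div_apply, h2, sub_self, Real.rpow_zero, Real.Gamma_one, div_one] at h
    exact h.mono_left nhdsWithin_le_nhds
  have hint : Tendsto (fun α : ℝ => ∫ y in (0 : ℝ)..1, -Real.sin (t - L * y ^ (1 / (2 - α))))
      (nhdsWithin 2 (Set.Ioo 1 2)) (nhds (-Real.sin t)) := by
    have h := (tendsto_integral_comp_rpow_atTop
      (g := fun x => -Real.sin (t - L * x)) (by fun_prop)).comp
      (tendsto_inv_nhdsGT_zero.comp hsub)
    simpa [Function.comp_def] using h
  simpa using hcoef.mul hint
end
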